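/- Let G be a finite simple graph whose vertex set is partitioned into two sets V₁ and V₂ with no edge of G joining a vertex of V₁ to a vertex of V₂, and let G₁ and G₂ be the subgraphs of G induced on V₁ and V₂ respectively. Then bdim(G) ≥ bdim(G₁) + bdim(G₂). In particular, the broadcast dimension of a disconnected graph is at least the sum of the broadcast dimensions of its connected components. -/

import Mathlib

open SimpleGraph

/-- `f` is a resolving broadcast of `G`: for any two distinct vertices `x, y` there is a
vertex `z` with `f z > 0` such that `min (d(x,z)) (f z + 1) ≠ min (d(y,z)) (f z + 1)`,
where distances are extended naturals (`⊤` for vertices in different components). -/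
def IsResolvingBroadcast {V : Type*} (G : SimpleGraph V) (f : V → ℕ) : Prop :=
  ∀ x y : V, x ≠ y → ∃ z : V, 0 < f z ∧
    min (G.edist x z) ((f z : ℕ∞) + 1) ≠ min (G.edist y z) ((f z : ℕ∞) + 1)

/-- The broadcast dimension of `G`: the minimum of `∑ v, f v` over all
resolving broadcasts `f` of `G`. -/
noncomputable def bdim {V : Type*} [Fintype V] (G : SimpleGraph V) : ℕ :=
  sInf {n : ℕ | ∃ f : V → ℕ, IsResolvingBroadcast G f ∧ ∑ v, f v = n}

namespace SimpleGraph

variable {V : Type*} {G : SimpleGraph V} {S : Set V}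

theorem Walk.mem_of_mem_support_of_adj_closed (hS : ∀ x y, G.Adj x y → x ∈ S → y ∈ S)
    {u v : V} (p : G.Walk u v) (hu : u ∈ S) : ∀ w ∈ p.support, w ∈ S := by
  induction p with
  | nil => simpa using hu
  | cons h p ih =>
    intro w hw
    rcases List.mem_cons.mp hw with rfl | hw
    · exact hu
    · exact ih (hS _ _ h hu) w hw

theorem edist_eq_top_of_adj_closed (hS : ∀ x y, G.Adj x y → x ∈ S → y ∈ S)
    {u v : V} (hu : u ∈ S) (hv : v ∉ S) : G.edist u v = ⊤ := by
  refine edist_eq_top_of_not_reachable ?_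
  rintro ⟨p⟩
  exact hv (p.mem_of_mem_support_of_adj_closed hS hu v p.end_mem_support)

theorem edist_induce_of_adj_closed (hS : ∀ x y, G.Adj x y → x ∈ S → y ∈ S) (u v : S) :
    (G.induce S).edist u v = G.edist u v := by
  apply le_antisymm
  · refine le_iInf fun p => ?_
    have hp := p.mem_of_mem_support_of_adj_closed hS u.2
    have h := edist_le (p.induce S hp)
    have hl : (p.induce S hp).length = p.length := by
      rw [← Walk.length_map (Embedding.induce S).toHom, Walk.map_induce]
      rfl
    rwa [hl] at h
  · refine le_iInf fun p => ?_
    have h := edist_le (p.map (Embedding.induce S).toHom)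
    rwa [Walk.length_map] at h

end SimpleGraph

theorem IsResolvingBroadcast.induce {V : Type*} {G : SimpleGraph V} {f : V → ℕ} {S : Set V}
    (hf : IsResolvingBroadcast G f) (hS : ∀ x y, G.Adj x y → x ∈ S → y ∈ S) :
    IsResolvingBroadcast (G.induce S) (fun v => f v) := by
  intro x y hxy
  obtain ⟨z, hz, hne⟩ := hf x y (Subtype.coe_injective.ne hxy)
  by_cases hzS : z ∈ S
  · refine ⟨⟨z, hzS⟩, hz, ?_⟩
    simpa only [edist_induce_of_adj_closed hS] using hne
  · simp [edist_eq_top_of_adj_closed hS _ hzS] at hne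

theorem isResolvingBroadcast_one {V : Type*} (G : SimpleGraph V) :
    IsResolvingBroadcast G (fun _ => 1) := by
  intro x y hxy
  refine ⟨x, one_pos, ?_⟩
  have h : 0 < G.edist y x := edist_pos_of_ne hxy.symm
  simpa [edist_self] using (lt_min h (by norm_num : (0 : ℕ∞) < 1 + 1)).ne

theorem IsResolvingBroadcast.bdim_le {V : Type*} [Fintype V] {G : SimpleGraph V} {f : V → ℕ}
    (hf : IsResolvingBroadcast G f) : bdim G ≤ ∑ v, f v :=
  Nat.sInf_le ⟨f, hf, rfl⟩

theorem exists_isResolvingBroadcast_sum_eq_bdim {V : Type*} [Fintype V] (G : SimpleGraph V) :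
    ∃ f : V → ℕ, IsResolvingBroadcast G f ∧ ∑ v, f v = bdim G :=
  Nat.sInf_mem (s := {n | ∃ f : V → ℕ, IsResolvingBroadcast G f ∧ ∑ v, f v = n})
    ⟨_, _, isResolvingBroadcast_one G, rfl⟩

/-- If the vertex set of `G` is partitioned into `V₁` and `V₂` with no edges between
them, then `bdim G ≥ bdim G₁ + bdim G₂` where `G₁, G₂` are the induced subgraphs. -/
theorem bdim_union_parts_le {V : Type*} [Fintype V] (G : SimpleGraph V)
    (V₁ V₂ : Set V) [Fintype V₁] [Fintype V₂]
    (hU : V₁ ∪ V₂ = Set.univ) (hD : Disjoint V₁ V₂)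
    (hE : ∀ x y : V, G.Adj x y → ¬(x ∈ V₁ ∧ y ∈ V₂)) :
    bdim (G.induce V₁) + bdim (G.induce V₂) ≤ bdim G := by
  classical
  have hc : V₂ = V₁ᶜ :=
    (IsCompl.of_eq (Set.disjoint_iff_inter_eq_empty.mp hD) hU).compl_eq.symm
  have h₁ : ∀ x y, G.Adj x y → x ∈ V₁ → y ∈ V₁ := by
    intro x y h hx
    by_contra hy
    exact hE x y h ⟨hx, hc ▸ hy⟩
  have h₂ : ∀ x y, G.Adj x y → x ∈ V₂ → y ∈ V₂ := by
    intro x y h hx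
    rw [hc]
    exact fun hy => hE y x h.symm ⟨hy, hx⟩
  obtain ⟨f, hf, hsum⟩ := exists_isResolvingBroadcast_sum_eq_bdim G
  have hsplit : ∑ v : V₁, f v + ∑ v : V₂, f v = ∑ v, f v := by
    rw [Finset.sum_set_coe, Finset.sum_set_coe,
      ← Finset.sum_union (Set.disjoint_toFinset.mpr hD), ← Set.toFinset_union]
    simp [hU]
  rw [← hsum, ← hsplit]
  exact add_le_add (hf.induce h₁).bdim_le (hf.induce h₂).bdim_le
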